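/- arXiv:2206.09841 — 2 statements merged into one kernel-verified Lean document; each statement's English description precedes it below -/
import Mathlib

section
/- Let X be a real n×d matrix, y ∈ ℝⁿ, h ∈ ℝᵈ the diagonal of XᵀX, δ > 0. Let S ⊆ {1,…,d} be nonempty with X_Sᵀ X_S invertible and h_{Sᶜ} > X_{Sᶜ}ᵀ X_S (X_Sᵀ X_S)⁻¹ h_S componentwise, let β* ∈ ℝᵈ satisfy β* ≥ 0, Xβ* = y, supp(β*) = S, and assume β*_k > δ[(2X_Sᵀ X_S)⁻¹ h_S]_k for all k ∈ S. Set β^S := [β*_S − δ(2X_Sᵀ X_S)⁻¹ h_S, 0_{Sᶜ}]. Then every β' ≥ 0 that minimizes L_δ(β) = ‖Xβ − y‖₂² + δ⟨h, β⟩ over the nonnegative orthant is equal to β^S; i.e., β^S is the unique minimizer. -/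
open scoped BigOperators

/-- The Gram matrix `X_Sᵀ X_S` of the columns of `X` indexed by `S`. -/
noncomputable def colGram {n d : ℕ} (X : Matrix (Fin n) (Fin d) ℝ) (S : Finset (Fin d)) :
    Matrix {k // k ∈ S} {k // k ∈ S} ℝ :=
  Matrix.of fun k l => ∑ i, X i k.val * X i l.val

/-- The weighted Lasso objective `L_δ(β) = ‖Xβ - y‖₂² + δ⟨h, β⟩`, where
`h` is the diagonal of `XᵀX`. -/
noncomputable def weightedLasso {n d : ℕ} (X : Matrix (Fin n) (Fin d) ℝ)
    (y : Fin n → ℝ) (δ : ℝ) (β : Fin d → ℝ) : ℝ :=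
  (∑ i, (X.mulVec β i - y i) ^ 2) + δ * ∑ k, (∑ i, (X i k) ^ 2) * β k

/-- The primal witness `β^S = [β*_S - δ(2X_SᵀX_S)⁻¹ h_S, 0_{Sᶜ}]`. -/
noncomputable def betaWitness {n d : ℕ} (X : Matrix (Fin n) (Fin d) ℝ)
    (S : Finset (Fin d)) (δ : ℝ) (βstar : Fin d → ℝ) : Fin d → ℝ :=
  fun k =>
    if hk : k ∈ S then
      βstar k - δ * ((2 : ℝ) • colGram X S)⁻¹.mulVec
        (fun l => ∑ i, (X i l.val) ^ 2) ⟨k, hk⟩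
    else 0

/-- Exact second-order expansion of the weighted Lasso around a point whose residual is
`-(δ / 2) • X v`. -/
theorem weightedLasso_eq_add {n d : ℕ} (X : Matrix (Fin n) (Fin d) ℝ) (y : Fin n → ℝ) (δ : ℝ)
    (b v β : Fin d → ℝ) (hb : ∀ i, X.mulVec b i - y i = -(δ / 2) * X.mulVec v i) :
    weightedLasso X y δ β = weightedLasso X y δ b + ∑ i, (X.mulVec (β - b) i) ^ 2
      + δ * ∑ k, (β k - b k) * ((∑ i, (X i k) ^ 2) - X.transpose.mulVec (X.mulVec v) k) := by
  have hcross : ∑ k, (β k - b k) * X.transpose.mulVec (X.mulVec v) k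
      = ∑ i, X.mulVec (β - b) i * X.mulVec v i := by
    change (β - b) ⬝ᵥ X.transpose.mulVec (X.mulVec v) = X.mulVec (β - b) ⬝ᵥ X.mulVec v
    rw [Matrix.dotProduct_mulVec, Matrix.vecMul_transpose]
  have hsq : ∑ i, (X.mulVec β i - y i) ^ 2 = ∑ i, (X.mulVec b i - y i) ^ 2
      + ∑ i, (X.mulVec (β - b) i) ^ 2 - δ * ∑ i, X.mulVec (β - b) i * X.mulVec v i := by
    rw [Finset.mul_sum, ← Finset.sum_add_distrib, ← Finset.sum_sub_distrib]
    refine Finset.sum_congr rfl fun i _ => ?_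
    have h := hb i
    have hy : y i = X.mulVec b i + δ / 2 * X.mulVec v i := by linarith
    rw [Matrix.mulVec_sub, Pi.sub_apply, hy]
    ring
  have hlin : ∑ k, (β k - b k) * ((∑ i, (X i k) ^ 2) - X.transpose.mulVec (X.mulVec v) k)
      = ∑ k, (∑ i, (X i k) ^ 2) * β k - ∑ k, (∑ i, (X i k) ^ 2) * b k
        - ∑ k, (β k - b k) * X.transpose.mulVec (X.mulVec v) k := by
    rw [← Finset.sum_sub_distrib, ← Finset.sum_sub_distrib]
    exact Finset.sum_congr rfl fun k _ => by ring
  unfold weightedLasso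
  rw [hlin, hcross, hsq]
  ring

/-- `XᵀX v` only involves the columns indexed by `S` when `v` vanishes outside `S`. -/
theorem transpose_mulVec_mulVec_of_eq_zero {n d : ℕ} (X : Matrix (Fin n) (Fin d) ℝ)
    (S : Finset (Fin d)) (v : Fin d → ℝ) (hv : ∀ k, k ∉ S → v k = 0) (k : Fin d) :
    X.transpose.mulVec (X.mulVec v) k
      = ∑ l : {l // l ∈ S}, (∑ i, X i k * X i l.val) * v l.val := by
  rw [Finset.sum_coe_sort S fun l => (∑ i, X i k * X i l) * v l,
    Finset.sum_subset (Finset.subset_univ S) fun l _ hl => by rw [hv l hl, mul_zero]]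
  rw [Matrix.mulVec_mulVec]
  rfl

/-- On `S`, `XᵀX v` is the Gram matrix applied to the restriction of `v`. -/
theorem transpose_mulVec_mulVec_eq_colGram {n d : ℕ} (X : Matrix (Fin n) (Fin d) ℝ)
    (S : Finset (Fin d)) (v : Fin d → ℝ) (hv : ∀ k, k ∉ S → v k = 0) (k : {k // k ∈ S}) :
    X.transpose.mulVec (X.mulVec v) k.val = (colGram X S).mulVec (fun l => v l.val) k :=
  transpose_mulVec_mulVec_of_eq_zero X S v hv k.val

/-- If `X_SᵀX_S` is invertible, `X` is injective on vectors supported in `S`. -/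
theorem eq_zero_of_mulVec_eq_zero_of_colGram {n d : ℕ} (X : Matrix (Fin n) (Fin d) ℝ)
    (S : Finset (Fin d)) (hinv : IsUnit (colGram X S).det) (v : Fin d → ℝ)
    (hv : ∀ k, k ∉ S → v k = 0) (hX : X.mulVec v = 0) : v = 0 := by
  have hG : (colGram X S).mulVec (fun l => v l.val) = 0 := by
    funext k
    rw [← transpose_mulVec_mulVec_eq_colGram X S v hv k, hX, Matrix.mulVec_zero]
    rfl
  have h0 := Matrix.eq_zero_of_mulVec_eq_zero hinv.ne_zero hG
  funext k
  by_cases hk : k ∈ S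
  · exact congrFun h0 ⟨k, hk⟩
  · exact hv k hk

/-- In the standard noise regime, every minimiser of the weighted Lasso over the
nonnegative orthant equals `β^S`, i.e. `β^S` is the unique minimiser. -/
theorem betaWitness_unique_min {n d : ℕ} (X : Matrix (Fin n) (Fin d) ℝ)
    (y : Fin n → ℝ) (δ : ℝ) (hδ : 0 < δ)
    (S : Finset (Fin d)) (hS : S.Nonempty)
    (hinv : IsUnit (colGram X S).det)
    (hdom : ∀ k : Fin d, k ∉ S →
      (∑ l : {l // l ∈ S}, (∑ i, X i k * X i l.val) *
          (colGram X S)⁻¹.mulVec (fun l => ∑ i, (X i l.val) ^ 2) l) < ∑ i, (X i k) ^ 2)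
    (βstar : Fin d → ℝ) (hβpos : ∀ k, 0 ≤ βstar k) (hinterp : X.mulVec βstar = y)
    (hsupp : ∀ k, k ∈ S ↔ 0 < βstar k)
    (hδsmall : ∀ k : {l // l ∈ S},
      δ * ((2 : ℝ) • colGram X S)⁻¹.mulVec (fun l => ∑ i, (X i l.val) ^ 2) k
        < βstar k.val) :
    ∀ β' : Fin d → ℝ, (∀ k, 0 ≤ β' k) →
      (∀ β'' : Fin d → ℝ, (∀ k, 0 ≤ β'' k) →
        weightedLasso X y δ β' ≤ weightedLasso X y δ β'') →
      β' = betaWitness X S δ βstar := by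
  intro β' hβ' hmin
  set u : {k // k ∈ S} → ℝ := (colGram X S)⁻¹.mulVec (fun l => ∑ i, (X i l.val) ^ 2) with hu
  have hGu : (colGram X S).mulVec u = fun l => ∑ i, (X i l.val) ^ 2 := by
    rw [hu, Matrix.mulVec_mulVec, Matrix.mul_nonsing_inv _ hinv, Matrix.one_mulVec]
  have hhalf : ((2 : ℝ) • colGram X S)⁻¹.mulVec (fun l => ∑ i, (X i l.val) ^ 2)
      = (1 / 2 : ℝ) • u := by
    have hinv2 : ((2 : ℝ) • colGram X S)⁻¹ = (1 / 2 : ℝ) • (colGram X S)⁻¹ := by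
      refine Matrix.inv_eq_right_inv ?_
      rw [Matrix.smul_mul, Matrix.mul_smul, smul_smul, Matrix.mul_nonsing_inv _ hinv]
      norm_num
    rw [hinv2, Matrix.smul_mulVec]
  set v : Fin d → ℝ := fun k => if hk : k ∈ S then u ⟨k, hk⟩ else 0 with hv
  have hvS : (fun l : {l // l ∈ S} => v l.val) = u := by
    funext l
    simp [hv]
  have hv0 : ∀ k, k ∉ S → v k = 0 := fun k hk => by simp [hv, hk]
  have hbS : ∀ k, k ∉ S → betaWitness X S δ βstar k = 0 := fun k hk => by
    simp [betaWitness, hk]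
  have hb : betaWitness X S δ βstar = βstar - (δ / 2) • v := by
    funext k
    by_cases hk : k ∈ S
    · simp only [betaWitness, hk, hhalf, hv, dite_true, Pi.sub_apply, Pi.smul_apply, smul_eq_mul]
      ring
    · have hzero : βstar k = 0 :=
        le_antisymm (not_lt.mp fun h => hk ((hsupp k).mpr h)) (hβpos k)
      simp [hbS k hk, hv0 k hk, hzero]
  have hres : ∀ i, X.mulVec (betaWitness X S δ βstar) i - y i = -(δ / 2) * X.mulVec v i := by
    intro i
    rw [hb, Matrix.mulVec_sub, Matrix.mulVec_smul, hinterp]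
    simp
  have hbpos : ∀ k, 0 ≤ betaWitness X S δ βstar k := by
    intro k
    by_cases hk : k ∈ S
    · have h := hδsmall ⟨k, hk⟩
      simp only [betaWitness, hk, dite_true]
      linarith
    · exact (hbS k hk).ge
  have hgS : ∀ k, k ∈ S →
      (∑ i, (X i k) ^ 2) - X.transpose.mulVec (X.mulVec v) k = 0 := by
    intro k hk
    rw [transpose_mulVec_mulVec_eq_colGram X S v hv0 ⟨k, hk⟩, hvS, hGu, sub_self]
  have hgSc : ∀ k, k ∉ S →
      0 < (∑ i, (X i k) ^ 2) - X.transpose.mulVec (X.mulVec v) k := by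
    intro k hk
    have hlt := hdom k hk
    rw [transpose_mulVec_mulVec_of_eq_zero X S v hv0 k]
    simp only [← hvS] at hlt
    exact sub_pos.mpr hlt
  have hle := hmin _ hbpos
  rw [weightedLasso_eq_add X y δ _ v β' hres] at hle
  have hnn : ∀ k ∈ Finset.univ, 0 ≤ (β' k - betaWitness X S δ βstar k)
      * ((∑ i, (X i k) ^ 2) - X.transpose.mulVec (X.mulVec v) k) := by
    intro k _
    by_cases hk : k ∈ S
    · rw [hgS k hk, mul_zero]
    · rw [hbS k hk, sub_zero]
      exact mul_nonneg (hβ' k) (hgSc k hk).le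
  have hsq : ∀ i ∈ Finset.univ, 0 ≤ (X.mulVec (β' - betaWitness X S δ βstar) i) ^ 2 :=
    fun i _ => sq_nonneg _
  have hA := Finset.sum_nonneg hsq
  have hB := mul_nonneg hδ.le (Finset.sum_nonneg hnn)
  have hA0 := (Finset.sum_eq_zero_iff_of_nonneg hsq).mp (by linarith)
  have hB0 := (Finset.sum_eq_zero_iff_of_nonneg hnn).mp
    ((mul_eq_zero.mp (by linarith)).resolve_left hδ.ne')
  refine sub_eq_zero.mp (eq_zero_of_mulVec_eq_zero_of_colGram X S hinv _ (fun k hk => ?_) ?_)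
  · exact (mul_eq_zero.mp (hB0 k (Finset.mem_univ k))).resolve_right (hgSc k hk).ne'
  · funext i
    exact pow_eq_zero_iff two_ne_zero |>.mp (hA0 i (Finset.mem_univ i))
end

section
/- Let X be a real n×d matrix, y ∈ ℝⁿ, h ∈ ℝᵈ the diagonal of XᵀX, δ > 0. Let β, μ ∈ ℝᵈ be nonnegative vectors satisfying 2Xᵀ(Xβ − y) + δh = μ and ⟨μ, β⟩ = 0, and let β' ∈ ℝᵈ be nonnegative with L_δ(β') ≤ L_δ(β), where L_δ(β) = ‖Xβ − y‖₂² + δ⟨h, β⟩. Then ⟨μ, β'⟩ = 0; in particular β'_k = 0 whenever μ_k > 0. -/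
open scoped BigOperators

/-- The second-order expansion of the weighted Lasso objective, which is exact since the
objective is quadratic. -/
theorem weightedLasso_expansion {n d : ℕ} (X : Matrix (Fin n) (Fin d) ℝ)
    (y : Fin n → ℝ) (δ : ℝ) (β β' : Fin d → ℝ) :
    weightedLasso X y δ β' = weightedLasso X y δ β
      + ∑ i, (X.mulVec β' i - X.mulVec β i) ^ 2
      + ∑ k, (2 * (∑ i, X i k * (X.mulVec β i - y i)) + δ * ∑ i, (X i k) ^ 2)
          * (β' k - β k) := by
  have cross : ∑ k, (∑ i, X i k * (X.mulVec β i - y i)) * (β' k - β k)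
      = ∑ i, (X.mulVec β i - y i) * (X.mulVec β' i - X.mulVec β i) := by
    simp_rw [Finset.sum_mul]
    rw [Finset.sum_comm]
    refine Finset.sum_congr rfl fun i _ => ?_
    rw [← Pi.sub_apply (X.mulVec β'), ← Matrix.mulVec_sub]
    simp only [Matrix.mulVec, dotProduct, Finset.mul_sum, Pi.sub_apply]
    exact Finset.sum_congr rfl fun k _ => by ring
  have square : ∑ i, (X.mulVec β' i - y i) ^ 2 = ∑ i, (X.mulVec β i - y i) ^ 2
      + ∑ i, (X.mulVec β' i - X.mulVec β i) ^ 2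
      + 2 * ∑ i, (X.mulVec β i - y i) * (X.mulVec β' i - X.mulVec β i) := by
    rw [Finset.mul_sum, ← Finset.sum_add_distrib, ← Finset.sum_add_distrib]
    exact Finset.sum_congr rfl fun i _ => by ring
  have linear : ∑ k, (2 * (∑ i, X i k * (X.mulVec β i - y i)) + δ * ∑ i, (X i k) ^ 2)
        * (β' k - β k)
      = 2 * ∑ k, (∑ i, X i k * (X.mulVec β i - y i)) * (β' k - β k)
        + δ * ∑ k, (∑ i, (X i k) ^ 2) * β' k - δ * ∑ k, (∑ i, (X i k) ^ 2) * β k := by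
    rw [Finset.mul_sum, Finset.mul_sum, Finset.mul_sum, ← Finset.sum_add_distrib,
      ← Finset.sum_sub_distrib]
    exact Finset.sum_congr rfl fun k _ => by ring
  rw [linear, cross]
  unfold weightedLasso
  rw [square]
  ring

/-- If `(β, μ)` is a nonnegative pair satisfying the KKT conditions for the weighted Lasso
and `β'` is nonnegative with `L_δ(β') ≤ L_δ(β)`, then `⟨μ, β'⟩ = 0`; in particular
`β'_k = 0` whenever `μ_k > 0`. -/
theorem kkt_orthogonality_of_le {n d : ℕ} (X : Matrix (Fin n) (Fin d) ℝ)
    (y : Fin n → ℝ) (δ : ℝ) (hδ : 0 < δ) (β μ : Fin d → ℝ)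
    (hβ : ∀ k, 0 ≤ β k) (hμ : ∀ k, 0 ≤ μ k)
    (hKKT : ∀ k, 2 * (∑ i, X i k * (X.mulVec β i - y i)) + δ * ∑ i, (X i k) ^ 2 = μ k)
    (horth : ∑ k, μ k * β k = 0)
    (β' : Fin d → ℝ) (hβ' : ∀ k, 0 ≤ β' k)
    (hle : weightedLasso X y δ β' ≤ weightedLasso X y δ β) :
    (∑ k, μ k * β' k = 0) ∧ ∀ k, 0 < μ k → β' k = 0 := by
  have expansion := weightedLasso_expansion X y δ β β'
  simp_rw [hKKT, mul_sub, Finset.sum_sub_distrib, horth] at expansion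
  have square_nonneg : 0 ≤ ∑ i, (X.mulVec β' i - X.mulVec β i) ^ 2 :=
    Finset.sum_nonneg fun i _ => sq_nonneg _
  have term_nonneg : ∀ k ∈ Finset.univ, 0 ≤ μ k * β' k := fun k _ => mul_nonneg (hμ k) (hβ' k)
  have sum_eq_zero : ∑ k, μ k * β' k = 0 :=
    le_antisymm (by linarith) (Finset.sum_nonneg term_nonneg)
  refine ⟨sum_eq_zero, fun k hk => ?_⟩
  have := (Finset.sum_eq_zero_iff_of_nonneg term_nonneg).mp sum_eq_zero k (Finset.mem_univ k)
  exact (mul_eq_zero.mp this).resolve_left hk.ne'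
end
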